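/- For every weakly-hierarchical visibly pushdown automaton A = (Q, Σ, ⊥, δ, Q0, F) there exists a live weakly-hierarchical visibly pushdown automaton A' whose state set is Q ∪ {q_s} for a single fresh sink state q_s ∉ Q, with the same alphabet Σ, the same initial states Q0 and the same accepting states F, such that L(A') = L(A). That is, every VPA can be converted to live form by adding one sink state. -/

import Mathlib

/-- The kind of a symbol in a visibly pushdown alphabet:
internal, call, or return. -/
inductive SymKind : Type
  | int | call | ret
deriving DecidableEq

/-- A weakly-hierarchical visibly pushdown automaton over states `Q` and
alphabet `S`.  The partition of the alphabet is given by `kind`; the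
bottom-of-stack symbol is implicit (stacks are lists of states, the empty
list playing the role of `⊥`, and the head of the list being the topmost
symbol). -/
structure VPA (Q : Type) (S : Type) where
  kind : S → SymKind
  δi : Q → S → Q → Prop
  δc : Q → S → Q → Prop
  δr : Q → S → Q → Q → Prop
  Q0 : Set Q
  F : Set Q
  Q0_nonempty : Q0.Nonempty
  δi_kind : ∀ p a q, δi p a q → kind a = SymKind.int
  δc_kind : ∀ p c q, δc p c q → kind c = SymKind.call
  δr_kind : ∀ p r qh q, δr p r qh q → kind r = SymKind.ret

namespace VPA

variable {Q S : Type}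

/-- A configuration: current state together with the stack
(head = topmost symbol; `[]` = the empty stack `⊥`). -/
abbrev Config (Q : Type) := Q × List Q

/-- One step of the automaton on a symbol. Internal symbols leave the stack
unchanged, call symbols push the current state, return symbols pop the
matching topmost stack symbol. -/
def Step (A : VPA Q S) (c : Config Q) (s : S) (c' : Config Q) : Prop :=
  match A.kind s with
  | SymKind.int  => A.δi c.1 s c'.1 ∧ c'.2 = c.2
  | SymKind.call => A.δc c.1 s c'.1 ∧ c'.2 = c.1 :: c.2
  | SymKind.ret  => ∃ qh, A.δr c.1 s qh c'.1 ∧ c.2 = qh :: c'.2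

/-- `ρ` is a run of `A` on the word `w`. -/
def IsRunOn (A : VPA Q S) (w : List S) (ρ : Fin (w.length + 1) → Config Q) : Prop :=
  ∀ i : Fin w.length, A.Step (ρ i.castSucc) (w.get i) (ρ i.succ)

/-- A run is initial if it starts in an initial state with the empty stack `⊥`. -/
def IsInitial (A : VPA Q S) {n : ℕ} (ρ : Fin (n + 1) → Config Q) : Prop :=
  (ρ 0).1 ∈ A.Q0 ∧ (ρ 0).2 = []

/-- `A` accepts `w` if some initial run of `A` on `w` ends in an accepting state. -/
def Accepts (A : VPA Q S) (w : List S) : Prop :=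
  ∃ ρ : Fin (w.length + 1) → Config Q,
    A.IsRunOn w ρ ∧ A.IsInitial ρ ∧ (ρ (Fin.last w.length)).1 ∈ A.F

/-- The language of `A`. -/
def lang (A : VPA Q S) : Set (List S) := {w | A.Accepts w}

/-- A configuration is reachable if it occurs in some initial run of `A`. -/
def Reachable (A : VPA Q S) (c : Config Q) : Prop :=
  ∃ (w : List S) (ρ : Fin (w.length + 1) → Config Q),
    A.IsRunOn w ρ ∧ A.IsInitial ρ ∧ ∃ i, ρ i = c

/-- `tops A q` = set of topmost stack symbols of reachable stacks for `q`
(`none` plays the role of the bottom-of-stack symbol `⊥`). -/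
def tops (A : VPA Q S) (q : Q) : Set (Option Q) :=
  {t | ∃ σ : List Q, A.Reachable (q, σ) ∧ σ.head? = t}

/-- `A` is live: every state has outgoing transitions for every internal and
call symbol, and has an outgoing return transition for return symbol `s` and
stack symbol `qh` if and only if `qh` is the topmost symbol of some
reachable stack. -/
def Live (A : VPA Q S) : Prop :=
  (∀ q s, A.kind s = SymKind.int → ∃ q', A.δi q s q') ∧
  (∀ q s, A.kind s = SymKind.call → ∃ q', A.δc q s q') ∧
  (∀ q s qh, A.kind s = SymKind.ret →
    ((∃ q', A.δr q s qh q') ↔ some qh ∈ A.tops q))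

/-- `R` is a reachability-aware quotienting (RAQ) relation for `A`. -/
def IsRAQ (A : VPA Q S) (R : Q → Q → Prop) : Prop :=
  Equivalence R ∧
  ∀ p q, R p q →
    (p ∈ A.F ↔ q ∈ A.F) ∧
    (∀ a p', A.δi p a p' → ∃ q', A.δi q a q' ∧ R p' q') ∧
    (∀ a q', A.δi q a q' → ∃ p', A.δi p a p' ∧ R p' q') ∧
    (∀ c p', A.δc p c p' → ∃ q', A.δc q c q' ∧ R p' q') ∧
    (∀ c q', A.δc q c q' → ∃ p', A.δc p c p' ∧ R p' q') ∧
    (∀ ph qh, R ph qh →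
      ((∀ r p', A.δr p r ph p' → ∃ q', A.δr q r qh q' ∧ R p' q') ∧
       (∀ r q', A.δr q r qh q' → ∃ p', A.δr p r ph p' ∧ R p' q'))
      ∨ some qh ∉ A.tops q ∨ some ph ∉ A.tops p)

/-- The quotient VPA `A/R` for an equivalence relation (setoid) `R` on states. -/
def quot (A : VPA Q S) (R : Setoid Q) : VPA (Quotient R) S where
  kind := A.kind
  δi := fun P a P' => ∃ p p', A.δi p a p' ∧
    Quotient.mk R p = P ∧ Quotient.mk R p' = P'
  δc := fun P c P' => ∃ p p', A.δc p c p' ∧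
    Quotient.mk R p = P ∧ Quotient.mk R p' = P'
  δr := fun P r Ph P' => ∃ p ph p', A.δr p r ph p' ∧
    Quotient.mk R p = P ∧ Quotient.mk R ph = Ph ∧ Quotient.mk R p' = P'
  Q0 := {P | ∃ q ∈ A.Q0, Quotient.mk R q = P}
  F := {P | ∃ q ∈ A.F, Quotient.mk R q = P}
  Q0_nonempty := by
    obtain ⟨q, hq⟩ := A.Q0_nonempty
    exact ⟨Quotient.mk R q, q, hq, rfl⟩
  δi_kind := by rintro P a P' ⟨p, p', h, -, -⟩; exact A.δi_kind p a p' h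
  δc_kind := by rintro P c P' ⟨p, p', h, -, -⟩; exact A.δc_kind p c p' h
  δr_kind := by rintro P r Ph P' ⟨p, ph, p', h, -, -, -⟩; exact A.δr_kind p r ph p' h

end VPA

/-- A word is matched-return if every prefix ending in a return symbol
has strictly more call symbols than return symbols before that return. -/
def MR {S : Type} (kind : S → SymKind) (w : List S) : Prop :=
  ∀ v r, (v ++ [r]) <+: w → kind r = SymKind.ret →
    v.countP (fun s => decide (kind s = SymKind.call)) >
      v.countP (fun s => decide (kind s = SymKind.ret))

namespace VPA

variable {Q S : Type}

/-- `A.Reaches w c` means that some initial run of `A` on `w` ends in `c`. -/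
inductive Reaches (A : VPA Q S) : List S → Config Q → Prop
  | nil {q : Q} : q ∈ A.Q0 → Reaches A [] (q, [])
  | snoc {w : List S} {c c' : Config Q} {s : S} :
      Reaches A w c → A.Step c s c' → Reaches A (w ++ [s]) c'

theorem IsRunOn.reaches_take {A : VPA Q S} {w : List S} {ρ : Fin (w.length + 1) → Config Q}
    (hρ : A.IsRunOn w ρ) (hi : A.IsInitial ρ) (k : ℕ) (hk : k < w.length + 1) :
    A.Reaches (w.take k) (ρ ⟨k, hk⟩) := by
  induction k with
  | zero =>
    have h : ρ ⟨0, hk⟩ = ((ρ 0).1, []) := Prod.ext rfl hi.2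
    rw [h, List.take_zero]
    exact .nil hi.1
  | succ k ih =>
    have hk' : k < w.length := by omega
    rw [← List.take_concat_get' w k hk']
    exact (ih (by omega)).snoc (hρ ⟨k, hk'⟩)

theorem Reaches.exists_nat_run {A : VPA Q S} {w : List S} {c : Config Q} (h : A.Reaches w c) :
    ∃ f : ℕ → Config Q, (f 0).1 ∈ A.Q0 ∧ (f 0).2 = [] ∧
      (∀ i (hi : i < w.length), A.Step (f i) w[i] (f (i + 1))) ∧ f w.length = c := by
  induction h with
  | @nil q hq => exact ⟨fun _ => (q, []), hq, rfl, by simp, rfl⟩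
  | @snoc w c c' s _ hs ih =>
    obtain ⟨f, h0, h0', hf, hl⟩ := ih
    refine ⟨Function.update f (w.length + 1) c', by simpa using h0, by simpa using h0', ?_,
      by simp⟩
    intro i hi
    rw [List.length_append, List.length_singleton] at hi
    rw [Function.update_of_ne (by omega)]
    rcases Nat.lt_succ_iff_lt_or_eq.mp hi with hi' | rfl
    · rw [Function.update_of_ne (by omega), List.getElem_append_left hi']
      exact hf i hi'
    · simpa [hl] using hs

theorem reaches_iff {A : VPA Q S} {w : List S} {c : Config Q} :
    A.Reaches w c ↔ ∃ ρ : Fin (w.length + 1) → Config Q,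
      A.IsRunOn w ρ ∧ A.IsInitial ρ ∧ ρ (Fin.last w.length) = c := by
  constructor
  · intro h
    obtain ⟨f, h0, h0', hf, hl⟩ := h.exists_nat_run
    exact ⟨fun i => f i, fun i => hf i i.2, ⟨h0, h0'⟩, hl⟩
  · rintro ⟨ρ, hρ, hi, rfl⟩
    have h := hρ.reaches_take hi w.length (by omega)
    rwa [List.take_length] at h

theorem reachable_iff {A : VPA Q S} {c : Config Q} :
    A.Reachable c ↔ ∃ w, A.Reaches w c := by
  constructor
  · rintro ⟨w, ρ, hρ, hi, ⟨k, hk⟩, rfl⟩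
    exact ⟨_, hρ.reaches_take hi k hk⟩
  · rintro ⟨w, h⟩
    obtain ⟨ρ, hρ, hi, hl⟩ := reaches_iff.mp h
    exact ⟨w, ρ, hρ, hi, _, hl⟩

theorem mem_lang_iff {A : VPA Q S} {w : List S} :
    w ∈ A.lang ↔ ∃ q ∈ A.F, ∃ σ, A.Reaches w (q, σ) := by
  constructor
  · rintro ⟨ρ, hρ, hi, hF⟩
    exact ⟨_, hF, _, reaches_iff.mpr ⟨ρ, hρ, hi, rfl⟩⟩
  · rintro ⟨q, hq, σ, h⟩
    obtain ⟨ρ, hρ, hi, hl⟩ := reaches_iff.mp h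
    exact ⟨ρ, hρ, hi, by rwa [hl]⟩

theorem mem_tops_iff {A : VPA Q S} {q : Q} {t : Option Q} :
    t ∈ A.tops q ↔ ∃ w σ, A.Reaches w (q, σ) ∧ σ.head? = t := by
  simp only [tops, Set.mem_ofPred_eq, reachable_iff]
  exact ⟨fun ⟨σ, ⟨w, h⟩, ht⟩ => ⟨w, σ, h, ht⟩, fun ⟨w, σ, h, ht⟩ => ⟨σ, ⟨w, h⟩, ht⟩⟩

/-- Remove the return transitions whose stack symbol never occurs on top of a reachable stack. -/
def pruneReturns (A : VPA Q S) : VPA Q S where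
  kind := A.kind
  δi := A.δi
  δc := A.δc
  δr := fun p r qh q => A.δr p r qh q ∧ some qh ∈ A.tops p
  Q0 := A.Q0
  F := A.F
  Q0_nonempty := A.Q0_nonempty
  δi_kind := A.δi_kind
  δc_kind := A.δc_kind
  δr_kind := fun p r qh q h => A.δr_kind p r qh q h.1

theorem pruneReturns_reaches_iff {A : VPA Q S} {w : List S} {c : Config Q} :
    A.pruneReturns.Reaches w c ↔ A.Reaches w c := by
  constructor
  · intro h
    induction h with
    | nil hq => exact .nil hq
    | @snoc w c c' s _ hs ih =>
      refine ih.snoc ?_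
      simp only [Step, pruneReturns] at hs ⊢
      cases hk : A.kind s <;> simp only [hk] at hs ⊢
      · exact hs
      · exact hs
      · obtain ⟨qh, h, hσ⟩ := hs
        exact ⟨qh, h.1, hσ⟩
  · intro h
    induction h with
    | nil hq => exact .nil hq
    | @snoc w c c' s hc hs ih =>
      refine ih.snoc ?_
      simp only [Step, pruneReturns] at hs ⊢
      cases hk : A.kind s <;> simp only [hk] at hs ⊢
      · exact hs
      · exact hs
      · obtain ⟨qh, h, hσ⟩ := hs
        exact ⟨qh, ⟨h, mem_tops_iff.mpr ⟨w, c.2, hc, by rw [hσ]; rfl⟩⟩, hσ⟩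

theorem pruneReturns_tops (A : VPA Q S) (q : Q) : A.pruneReturns.tops q = A.tops q := by
  ext t
  simp only [mem_tops_iff, pruneReturns_reaches_iff]

theorem pruneReturns_lang (A : VPA Q S) : A.pruneReturns.lang = A.lang := by
  ext w
  simp only [mem_lang_iff, pruneReturns_reaches_iff]
  rfl

/-- Add a sink state `none` to which every state has a transition on every symbol. -/
def addSink (A : VPA Q S) : VPA (Option Q) S where
  kind := A.kind
  δi := fun p a q => A.kind a = SymKind.int ∧
    ∀ q₀, q = some q₀ → ∃ p₀, p = some p₀ ∧ A.δi p₀ a q₀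
  δc := fun p c q => A.kind c = SymKind.call ∧
    ∀ q₀, q = some q₀ → ∃ p₀, p = some p₀ ∧ A.δc p₀ c q₀
  δr := fun p r qh q => A.kind r = SymKind.ret ∧
    ∀ q₀, q = some q₀ → ∃ p₀ h₀, p = some p₀ ∧ qh = some h₀ ∧ A.δr p₀ r h₀ q₀
  Q0 := some '' A.Q0
  F := some '' A.F
  Q0_nonempty := A.Q0_nonempty.image some
  δi_kind := fun _ _ _ h => h.1
  δc_kind := fun _ _ _ h => h.1
  δr_kind := fun _ _ _ _ h => h.1

theorem Reaches.addSink {A : VPA Q S} {w : List S} {c : Config Q} (h : A.Reaches w c) :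
    A.addSink.Reaches w (some c.1, c.2.map some) := by
  induction h with
  | nil hq => exact .nil (Set.mem_image_of_mem some hq)
  | @snoc w c c' s _ hs ih =>
    refine ih.snoc ?_
    simp only [Step, VPA.addSink] at hs ⊢
    cases hk : A.kind s <;> simp only [hk] at hs ⊢
    · simpa [hs.2] using hs.1
    · simpa [hs.2] using hs.1
    · obtain ⟨qh, h, hσ⟩ := hs
      exact ⟨some qh, by simpa using h, by simp [hσ]⟩

theorem Reaches.of_addSink {A : VPA Q S} {w : List S} {c : Config (Option Q)}
    (h : A.addSink.Reaches w c) (q : Q) (hq : c.1 = some q) :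
    ∃ σ : List Q, c.2 = σ.map some ∧ A.Reaches w (q, σ) := by
  induction h generalizing q with
  | nil hp =>
    obtain ⟨p, hp, rfl⟩ := hp
    obtain rfl := Option.some.inj hq
    exact ⟨[], rfl, .nil hp⟩
  | @snoc w c c' s _ hs ih =>
    simp only [Step, VPA.addSink] at hs
    cases hk : A.kind s <;> simp only [hk] at hs
    · obtain ⟨p, hp, hd⟩ := hs.1.2 q hq
      obtain ⟨σ, hσ, hr⟩ := ih p hp
      exact ⟨σ, hs.2.trans hσ, hr.snoc (by simpa [Step, hk] using hd)⟩
    · obtain ⟨p, hp, hd⟩ := hs.1.2 q hq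
      obtain ⟨σ, hσ, hr⟩ := ih p hp
      exact ⟨p :: σ, by simp [hs.2, hp, hσ], hr.snoc (by simpa [Step, hk] using hd)⟩
    · obtain ⟨_, ⟨-, hdr⟩, hpop⟩ := hs
      obtain ⟨p, ph, hp, rfl, hd⟩ := hdr q hq
      obtain ⟨σ, hσ, hr⟩ := ih p hp
      obtain ⟨ph', τ, rfl, hh, hτ⟩ := List.map_eq_cons_iff.mp (hσ.symm.trans hpop)
      obtain rfl := Option.some.inj hh
      exact ⟨τ, hτ.symm, hr.snoc (by simpa [Step, hk] using hd)⟩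

theorem addSink_lang (A : VPA Q S) : A.addSink.lang = A.lang := by
  ext w
  simp only [mem_lang_iff]
  constructor
  · rintro ⟨_, ⟨q, hq, rfl⟩, σ, h⟩
    obtain ⟨τ, -, hτ⟩ := h.of_addSink q rfl
    exact ⟨q, hq, τ, hτ⟩
  · rintro ⟨q, hq, σ, h⟩
    exact ⟨some q, ⟨q, hq, rfl⟩, _, h.addSink⟩

theorem addSink_pruneReturns_live (A : VPA Q S) : A.addSink.pruneReturns.Live := by
  refine ⟨fun q s hs => ⟨none, hs, by simp⟩, fun q s hs => ⟨none, hs, by simp⟩,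
    fun q s qh hs => ?_⟩
  rw [pruneReturns_tops]
  exact ⟨fun ⟨_, h⟩ => h.2, fun h => ⟨none, ⟨hs, by simp⟩, h⟩⟩

end VPA

/-- Every VPA can be converted to live form by adding a single fresh sink
state (here `none`, the states of the new automaton being `Option Q`),
keeping the alphabet, the initial states and the accepting states, and
preserving the language. -/
theorem exists_live_extension {Q S : Type} [Fintype Q] [Fintype S]
    (A : VPA Q S) :
    ∃ A' : VPA (Option Q) S,
      A'.kind = A.kind ∧
      A'.Live ∧
      A'.Q0 = some '' A.Q0 ∧
      A'.F = some '' A.F ∧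
      A'.lang = A.lang := by
  exact ⟨A.addSink.pruneReturns, rfl, A.addSink_pruneReturns_live, rfl, rfl,
    A.addSink.pruneReturns_lang.trans A.addSink_lang⟩
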